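/- arXiv:1202.2809 — 2 statements merged into one kernel-verified Lean document; each statement's English description precedes it below -/
import Mathlib

section
/- For Δ = ℝ, β = 2 and V(x) = log(1 + x²), the unique minimizer of I_V over M_1(ℝ) is the standard Cauchy distribution, i.e. the measure with density 1/(π(1 + x²)) with respect to Lebesgue measure on ℝ. -/
open MeasureTheory Filter Topology
open scoped ENNReal NNReal

/-- `⊤`-aware positive part of an extended real, as a value in `ℝ≥0∞`. -/
noncomputable def EReal.posPart' (x : EReal) : ℝ≥0∞ :=
  if x = ⊤ then ⊤ else ENNReal.ofReal x.toReal

/-- Integral of an `EReal`-valued function: positive part minus negative part. -/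
noncomputable def eIntegral {α : Type*} [MeasurableSpace α] (μ : Measure α) (f : α → EReal) :
    EReal :=
  ((∫⁻ x, (f x).posPart' ∂μ : ℝ≥0∞) : EReal) - ((∫⁻ x, (-(f x)).posPart' ∂μ : ℝ≥0∞) : EReal)

/-- `log (1/r)` as an extended real, equal to `+∞` at `r = 0`. -/
noncomputable def negLog (r : ℝ) : EReal :=
  if r = 0 then ⊤ else ((- Real.log r : ℝ) : EReal)

/-- The weighted logarithmic kernel `F_W(x,y) = (β/2) log(1/|x-y|) + W(x)/2 + W(y)/2`. -/
noncomputable def kern {α : Type*} [PseudoMetricSpace α] (β : ℝ) (W : α → EReal) (x y : α) :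
    EReal :=
  ((β / 2 : ℝ) : EReal) * negLog (dist x y) + ((2⁻¹ : ℝ) : EReal) * W x
    + ((2⁻¹ : ℝ) : EReal) * W y

/-- The weighted logarithmic energy `I_W(μ) = ∬ F_W(x,y) dμ(x) dμ(y)`. -/
noncomputable def energy {α : Type*} [MeasurableSpace α] [PseudoMetricSpace α] (β : ℝ)
    (W : α → EReal) (μ : Measure α) : EReal :=
  eIntegral (μ.prod μ) (fun p => kern β W p.1 p.2)

open Real in
/-- The Abel-regularised logarithmic kernel on the circle, as a Fourier series. -/
lemma hasSum_pow_mul_cos_div {r : ℝ} (hr0 : 0 ≤ r) (hr1 : r < 1) (φ : ℝ) :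
    HasSum (fun n : ℕ => r ^ n * cos (n * φ) / n)
      (-(1 / 2) * log (1 - 2 * r * cos φ + r ^ 2)) := by
  set z : ℂ := r * Complex.exp (φ * Complex.I) with hz
  have hzn : ‖z‖ < 1 := by
    rw [hz, norm_mul, Complex.norm_exp_ofReal_mul_I]
    simpa [abs_of_nonneg hr0] using hr1
  have h := Complex.hasSum_re (Complex.hasSum_taylorSeries_neg_log hzn)
  have hterm (n : ℕ) : (z ^ n / n).re = r ^ n * cos (n * φ) / n := by
    rw [hz, mul_pow, ← Complex.exp_nat_mul,
      show (n : ℂ) * (φ * Complex.I) = ((n * φ : ℝ) : ℂ) * Complex.I by push_cast; ring,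
      ← Complex.ofReal_pow, Complex.div_natCast_re, Complex.re_ofReal_mul,
      Complex.exp_ofReal_mul_I_re]
  have hnorm : ‖1 - z‖ ^ 2 = 1 - 2 * r * cos φ + r ^ 2 := by
    rw [← Complex.normSq_eq_norm_sq, Complex.normSq_apply, hz]
    simp only [Complex.sub_re, Complex.one_re, Complex.re_ofReal_mul, Complex.sub_im,
      Complex.one_im, Complex.im_ofReal_mul, Complex.exp_ofReal_mul_I_re,
      Complex.exp_ofReal_mul_I_im]
    linear_combination r ^ 2 * sin_sq_add_cos_sq φ
  have hval : (-Complex.log (1 - z)).re = -(1 / 2) * log (1 - 2 * r * cos φ + r ^ 2) := by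
    rw [← hnorm, log_pow, Complex.neg_re, Complex.log_re]
    push_cast
    ring
  rw [← hval]
  simpa only [hterm] using h

open Real in
lemma one_sub_sq_le_one_sub_mul_cos {r : ℝ} (hr0 : 0 ≤ r) (φ : ℝ) :
    (1 - r) ^ 2 ≤ 1 - 2 * r * cos φ + r ^ 2 := by
  nlinarith [cos_le_one φ]

open Real in
lemma integrable_log_one_sub_mul_cos {α : Type*} [MeasurableSpace α] {μ : Measure α}
    [IsFiniteMeasure μ] {f : α → ℝ} (hf : Measurable f) {r : ℝ} (hr0 : 0 ≤ r) (hr1 : r < 1) :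
    Integrable (fun a => log (1 - 2 * r * cos (f a) + r ^ 2)) μ := by
  have hpos : 0 < (1 - r) ^ 2 := by have := sub_pos.2 hr1; positivity
  refine Integrable.of_mem_Icc (log ((1 - r) ^ 2)) (log ((1 + r) ^ 2)) (by fun_prop)
    (.of_forall fun a => ?_)
  have h := one_sub_sq_le_one_sub_mul_cos hr0 (f a)
  refine ⟨log_le_log hpos h, log_le_log (hpos.trans_le h) ?_⟩
  nlinarith [neg_one_le_cos (f a)]

open Real in
lemma integral_cos_sub_prod (μ : Measure ℝ) [IsFiniteMeasure μ] {θ : ℝ → ℝ} (hθ : Measurable θ) :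
    ∫ p, cos (θ p.1 - θ p.2) ∂(μ.prod μ) =
      (∫ x, cos (θ x) ∂μ) ^ 2 + (∫ x, sin (θ x) ∂μ) ^ 2 := by
  have hc : Integrable (fun x => cos (θ x)) μ :=
    .of_bound (by fun_prop) 1 (.of_forall fun x => by simpa using abs_cos_le_one _)
  have hs : Integrable (fun x => sin (θ x)) μ :=
    .of_bound (by fun_prop) 1 (.of_forall fun x => by simpa using abs_sin_le_one _)
  simp_rw [cos_sub]
  rw [integral_add (hc.mul_prod hc) (hs.mul_prod hs),
    integral_prod_mul (fun x => cos (θ x)) fun x => cos (θ x),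
    integral_prod_mul (fun x => sin (θ x)) fun x => sin (θ x), sq, sq]

open Real in
/-- The regularised circular logarithmic energy has nonnegative Fourier coefficients. -/
lemma fourierCoeff_le_integral_log (μ : Measure ℝ) [IsFiniteMeasure μ] {θ : ℝ → ℝ}
    (hθ : Measurable θ) {r : ℝ} (hr0 : 0 ≤ r) (hr1 : r < 1) (n : ℕ) :
    r ^ n / n * ((∫ x, cos (n * θ x) ∂μ) ^ 2 + (∫ x, sin (n * θ x) ∂μ) ^ 2) ≤
      ∫ p, -(1 / 2) * log (1 - 2 * r * cos (θ p.1 - θ p.2) + r ^ 2) ∂(μ.prod μ) := by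
  set F : ℕ → ℝ × ℝ → ℝ := fun n p => r ^ n * cos (n * (θ p.1 - θ p.2)) / n with hF
  have hbound (n : ℕ) (p : ℝ × ℝ) : ‖F n p‖ ≤ r ^ n := by
    rw [hF, norm_div, norm_mul, norm_of_nonneg (pow_nonneg hr0 n), RCLike.norm_natCast]
    rcases n.eq_zero_or_pos with rfl | hn
    · simp
    · refine div_le_of_le_mul₀ (by positivity) (by positivity) ?_
      gcongr
      exact (abs_cos_le_one _).trans (by exact_mod_cast hn)
  have hint (n : ℕ) : Integrable (F n) (μ.prod μ) :=
    .of_bound (by fun_prop) (r ^ n) (.of_forall (hbound n))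
  have hsum : Summable fun n => ∫ p, ‖F n p‖ ∂(μ.prod μ) := by
    refine .of_nonneg_of_le (fun n => by positivity) (fun n => ?_)
      ((summable_geometric_of_lt_one hr0 hr1).mul_left ((μ.prod μ).real Set.univ))
    calc ∫ p, ‖F n p‖ ∂(μ.prod μ) ≤ ∫ _, r ^ n ∂(μ.prod μ) :=
          integral_mono (hint n).norm (integrable_const _) (hbound n)
      _ = _ := by simp
  have h := hasSum_integral_of_summable_integral_norm hint hsum
  simp_rw [hF, (hasSum_pow_mul_cos_div hr0 hr1 _).tsum_eq] at h
  have hterm (n : ℕ) : ∫ p, r ^ n * cos (n * (θ p.1 - θ p.2)) / n ∂(μ.prod μ) =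
      r ^ n / n * ((∫ x, cos (n * θ x) ∂μ) ^ 2 + (∫ x, sin (n * θ x) ∂μ) ^ 2) := by
    rw [← integral_cos_sub_prod μ (hθ.const_mul (n : ℝ)), ← integral_const_mul]
    exact integral_congr_ae (.of_forall fun p => by ring_nf)
  simp_rw [hterm] at h
  exact le_hasSum h n fun m _ => by positivity

lemma ofReal_integral_le_lintegral_ofReal {α : Type*} [MeasurableSpace α] {μ : Measure α}
    {f : α → ℝ} (hf : Integrable f μ) :
    ENNReal.ofReal (∫ x, f x ∂μ) ≤ ∫⁻ x, ENNReal.ofReal (f x) ∂μ := by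
  have hp := hf.pos_part
  calc ENNReal.ofReal (∫ x, f x ∂μ) ≤ ENNReal.ofReal (∫ x, max (f x) 0 ∂μ) :=
        ENNReal.ofReal_le_ofReal (integral_mono hf hp fun x => le_max_left _ _)
    _ = ∫⁻ x, ENNReal.ofReal (max (f x) 0) ∂μ :=
        ofReal_integral_eq_lintegral_ofReal hp (.of_forall fun x => le_max_right _ _)
    _ = _ := by simp

/-- The kernel of the Cauchy ensemble in the angular coordinate `arctan`. -/
noncomputable def sinKernel (x y : ℝ) : ℝ≥0∞ :=
  if x = y then ⊤ else ENNReal.ofReal (-Real.log |Real.sin (Real.arctan x - Real.arctan y)|)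

open Real in
lemma sin_arctan_sub (x y : ℝ) :
    sin (arctan x - arctan y) = (x - y) / (√(1 + x ^ 2) * √(1 + y ^ 2)) := by
  rw [sin_sub, sin_arctan, cos_arctan, sin_arctan, cos_arctan]
  field_simp

open Real in
lemma sin_arctan_sub_ne_zero {x y : ℝ} (h : x ≠ y) : sin (arctan x - arctan y) ≠ 0 := by
  rw [sin_arctan_sub]
  have := sub_ne_zero.2 h
  positivity

open Real in
lemma kern_eq_neg_log_abs_sin {x y : ℝ} (h : x ≠ y) :
    kern 2 (fun x : ℝ => ((log (1 + x ^ 2) : ℝ) : EReal)) x y =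
      ((-log |sin (arctan x - arctan y)| : ℝ) : EReal) := by
  have hd : |x - y| ≠ 0 := abs_ne_zero.2 (sub_ne_zero.2 h)
  rw [kern, negLog, if_neg (by rwa [dist_eq]), dist_eq, ← EReal.coe_mul, ← EReal.coe_mul,
    ← EReal.coe_mul, ← EReal.coe_add, ← EReal.coe_add, sin_arctan_sub, abs_div, abs_mul,
    abs_of_nonneg (sqrt_nonneg _), abs_of_nonneg (sqrt_nonneg _),
    log_div hd (by positivity), log_mul (by positivity) (by positivity),
    log_sqrt (by positivity), log_sqrt (by positivity)]
  congr 1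
  ring

open Real in
lemma energy_log_one_add_sq (μ : Measure ℝ) :
    energy 2 (fun x : ℝ => ((log (1 + x ^ 2) : ℝ) : EReal)) μ =
      ((∫⁻ p, sinKernel p.1 p.2 ∂(μ.prod μ) : ℝ≥0∞) : EReal) := by
  have hdiag (x : ℝ) : kern 2 (fun x : ℝ => ((log (1 + x ^ 2) : ℝ) : EReal)) x x = ⊤ := by
    rw [kern, negLog, if_pos (dist_self x), ← EReal.coe_mul,
      EReal.coe_mul_top_of_pos (by norm_num), EReal.top_add_coe, EReal.top_add_coe]
  have hpos (p : ℝ × ℝ) : (kern 2 (fun x : ℝ => ((log (1 + x ^ 2) : ℝ) : EReal)) p.1 p.2).posPart'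
      = sinKernel p.1 p.2 := by
    by_cases h : p.1 = p.2
    · rw [h, hdiag, EReal.posPart', if_pos rfl, sinKernel, if_pos rfl]
    · rw [kern_eq_neg_log_abs_sin h, EReal.posPart', if_neg (EReal.coe_ne_top _),
        EReal.toReal_coe, sinKernel, if_neg h]
  have hneg (p : ℝ × ℝ) :
      (-(kern 2 (fun x : ℝ => ((log (1 + x ^ 2) : ℝ) : EReal)) p.1 p.2)).posPart' = 0 := by
    by_cases h : p.1 = p.2
    · rw [h, hdiag, EReal.posPart', EReal.neg_top, if_neg bot_ne_top]
      simp
    · rw [kern_eq_neg_log_abs_sin h, EReal.posPart', ← EReal.coe_neg,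
        if_neg (EReal.coe_ne_top _), EReal.toReal_coe, neg_neg, ENNReal.ofReal_eq_zero]
      exact log_nonpos (abs_nonneg _) (abs_sin_le_one _)
  simp [energy, eIntegral, hpos, hneg]

open Real in
lemma regularized_le_sinKernel {r : ℝ} (hr0 : 0 < r) (x y : ℝ) :
    ENNReal.ofReal (log 2 + log r / 2 +
      -(1 / 2) * log (1 - 2 * r * cos (2 * arctan x - 2 * arctan y) + r ^ 2)) ≤
      sinKernel x y := by
  by_cases h : x = y
  · simp [sinKernel, h]
  rw [sinKernel, if_neg h]
  refine ENNReal.ofReal_le_ofReal ?_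
  have hs : 0 < |sin (arctan x - arctan y)| := abs_pos.2 (sin_arctan_sub_ne_zero h)
  have key : 2 ^ 2 * r * |sin (arctan x - arctan y)| ^ 2 ≤
      1 - 2 * r * cos (2 * arctan x - 2 * arctan y) + r ^ 2 := by
    rw [← mul_sub, cos_two_mul, cos_sq', sq_abs]
    nlinarith [sq_nonneg (1 - r)]
  have hlog := log_le_log (by positivity) key
  rw [log_mul (by positivity) (by positivity), log_mul (by positivity) (by positivity), log_pow,
    log_pow] at hlog
  push_cast at hlog
  linarith

open Real in
/-- The energy dominates `log 2` plus each of its Fourier modes. -/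
lemma log_two_add_le_lintegral_sinKernel (μ : Measure ℝ) [IsProbabilityMeasure μ] (n : ℕ) :
    ENNReal.ofReal (log 2 + 1 / n * ((∫ x, cos (n * (2 * arctan x)) ∂μ) ^ 2 +
      (∫ x, sin (n * (2 * arctan x)) ∂μ) ^ 2)) ≤ ∫⁻ p, sinKernel p.1 p.2 ∂(μ.prod μ) := by
  set A := (∫ x, cos (n * (2 * arctan x)) ∂μ) ^ 2 + (∫ x, sin (n * (2 * arctan x)) ∂μ) ^ 2
  have hmeas : Measurable fun x : ℝ => 2 * arctan x := by fun_prop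
  have hlt (r : ℝ) (hr : r ∈ Set.Ioo (0 : ℝ) 1) :
      ENNReal.ofReal (log 2 + log r / 2 + r ^ n / n * A) ≤
        ∫⁻ p, sinKernel p.1 p.2 ∂(μ.prod μ) := by
    have hint : Integrable (fun p : ℝ × ℝ => -(1 / 2) *
        log (1 - 2 * r * cos (2 * arctan p.1 - 2 * arctan p.2) + r ^ 2)) (μ.prod μ) :=
      (integrable_log_one_sub_mul_cos (by fun_prop) hr.1.le hr.2).const_mul _
    calc _ ≤ ENNReal.ofReal (∫ p, (log 2 + log r / 2 + -(1 / 2) *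
            log (1 - 2 * r * cos (2 * arctan p.1 - 2 * arctan p.2) + r ^ 2)) ∂(μ.prod μ)) := by
          refine ENNReal.ofReal_le_ofReal ?_
          rw [integral_add (integrable_const _) hint, integral_const]
          simpa using fourierCoeff_le_integral_log μ hmeas hr.1.le hr.2 n
      _ ≤ _ := ofReal_integral_le_lintegral_ofReal ((integrable_const _).add hint)
      _ ≤ _ := lintegral_mono fun p => regularized_le_sinKernel hr.1 p.1 p.2
  have hlim : Tendsto (fun r : ℝ => ENNReal.ofReal (log 2 + log r / 2 + r ^ n / n * A))
      (𝓝[<] 1) (𝓝 (ENNReal.ofReal (log 2 + 1 / n * A))) := by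
    have hc : ContinuousAt (fun r : ℝ => log 2 + log r / 2 + r ^ n / n * A) 1 := by
      have := continuousAt_log one_ne_zero
      fun_prop
    simpa using (ENNReal.tendsto_ofReal hc.tendsto).mono_left nhdsWithin_le_nhds
  exact le_of_tendsto hlim (by filter_upwards [Ioo_mem_nhdsLT one_pos] using hlt)

open Real in
/-- The inclusion of the line into the circle `ℝ / πℤ` by the angular coordinate. -/
noncomputable def arctanCircle (x : ℝ) : AddCircle π := (arctan x : AddCircle π)

open Real in
lemma measurableEmbedding_arctanCircle : MeasurableEmbedding arctanCircle := by
  have : Fact (0 < π) := ⟨pi_pos⟩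
  refine Continuous.measurableEmbedding
    ((AddCircle.continuous_mk' π).comp continuous_arctan) fun x y h => ?_
  have hmem (z : ℝ) : arctan z ∈ Set.Ico (-(π / 2)) (-(π / 2) + π) :=
    ⟨(neg_pi_div_two_lt_arctan z).le, by linarith [arctan_lt_pi_div_two z]⟩
  exact arctan_injective ((AddCircle.coe_eq_coe_iff_of_mem_Ico (hmem x) (hmem y)).1 h)

/-- A finite measure on the circle is determined by its Fourier coefficients. -/
lemma AddCircle.measure_ext_of_integral_fourier {T : ℝ} [Fact (0 < T)]
    {μ ν : Measure (AddCircle T)} [IsFiniteMeasure μ] [IsFiniteMeasure ν]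
    (h : ∀ n : ℤ, ∫ x, fourier n x ∂μ = ∫ x, fourier n x ∂ν) : μ = ν := by
  have hint (ρ : Measure (AddCircle T)) [IsFiniteMeasure ρ] (f : C(AddCircle T, ℂ)) :
      Integrable f ρ :=
    .of_bound f.continuous.aestronglyMeasurable ‖f‖ (.of_forall f.norm_coe_le_norm)
  have hcont (ρ : Measure (AddCircle T)) [IsFiniteMeasure ρ] :
      Continuous fun f : C(AddCircle T, ℂ) => ∫ x, f x ∂ρ := by
    refine (LipschitzWith.of_dist_le_mul (K := (ρ Set.univ).toNNReal) fun f g => ?_).continuous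
    rw [dist_eq_norm, ← integral_sub (hint ρ f) (hint ρ g), dist_eq_norm, mul_comm]
    exact norm_integral_le_of_norm_le_const (.of_forall (f - g).norm_coe_le_norm)
  have hall (f : C(AddCircle T, ℂ)) : ∫ x, f x ∂μ = ∫ x, f x ∂ν := by
    have hf : f ∈ closure (Submodule.span ℂ (Set.range (fourier (T := T))) : Set _) := by
      rw [← Submodule.topologicalClosure_coe, span_fourier_closure_eq_top]
      trivial
    refine closure_minimal (fun g hg => ?_) (isClosed_eq (hcont μ) (hcont ν)) hf
    induction hg using Submodule.span_induction with
    | mem g hg => obtain ⟨n, rfl⟩ := hg; exact h n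
    | zero => simp
    | add g₁ g₂ _ _ h₁ h₂ =>
      simp only [Set.mem_ofPred_eq, ContinuousMap.add_apply] at *
      rw [integral_add (hint μ _) (hint μ _), integral_add (hint ν _) (hint ν _), h₁, h₂]
    | smul c g _ hg =>
      simp only [Set.mem_ofPred_eq, ContinuousMap.smul_apply] at *
      rw [integral_smul, integral_smul, hg]
  refine ext_of_forall_integral_eq_of_IsFiniteMeasure fun f => ?_
  have := hall ⟨fun x => (f x : ℂ), by fun_prop⟩
  simp only [ContinuousMap.coe_mk, integral_complex_ofReal] at this
  exact_mod_cast this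

open Real in
lemma fourier_arctanCircle (n : ℤ) (x : ℝ) :
    fourier n (arctanCircle x) =
      (cos (n * (2 * arctan x)) : ℂ) + (sin (n * (2 * arctan x)) : ℂ) * Complex.I := by
  rw [arctanCircle, fourier_coe_apply]
  push_cast
  rw [← Complex.exp_mul_I]
  congr 1
  have : (π : ℂ) ≠ 0 := by exact_mod_cast pi_ne_zero
  field_simp

open Real in
/-- Probability measures of energy at most `log 2` have vanishing nonconstant Fourier modes. -/
lemma integral_fourier_eq_zero {μ : Measure ℝ} [IsProbabilityMeasure μ]
    (h : ∫⁻ p, sinKernel p.1 p.2 ∂(μ.prod μ) ≤ ENNReal.ofReal (log 2)) {n : ℤ} (hn : n ≠ 0) :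
    ∫ x, fourier n (arctanCircle x) ∂μ = 0 := by
  obtain ⟨m, hm⟩ := n.eq_nat_or_neg
  have hle := (ENNReal.ofReal_le_ofReal_iff (log_nonneg one_le_two)).1
    ((log_two_add_le_lintegral_sinKernel μ m).trans h)
  have hpos : (0 : ℝ) < 1 / m := by
    have : 0 < m := by lia
    positivity
  set C := ∫ x, cos (m * (2 * arctan x)) ∂μ
  set S := ∫ x, sin (m * (2 * arctan x)) ∂μ
  have hsum : C ^ 2 + S ^ 2 ≤ 0 := by
    by_contra! h'
    linarith [mul_pos hpos h']
  have hC0 : C = 0 := by nlinarith [sq_nonneg C, sq_nonneg S]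
  have hS0 : S = 0 := by nlinarith [sq_nonneg C, sq_nonneg S]
  have hcos : ∫ x, cos (n * (2 * arctan x)) ∂μ = 0 := by
    rcases hm with rfl | rfl <;> simpa [neg_mul] using hC0
  have hsin : ∫ x, sin (n * (2 * arctan x)) ∂μ = 0 := by
    rcases hm with rfl | rfl <;> simpa [neg_mul, integral_neg] using hS0
  simp_rw [fourier_arctanCircle]
  have hic : Integrable (fun x => cos (n * (2 * arctan x))) μ :=
    .of_bound (by fun_prop) 1 (.of_forall fun x => by simpa using abs_cos_le_one _)
  have his : Integrable (fun x => sin (n * (2 * arctan x))) μ :=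
    .of_bound (by fun_prop) 1 (.of_forall fun x => by simpa using abs_sin_le_one _)
  rw [integral_add hic.ofReal (his.ofReal.mul_const _), integral_mul_const,
    integral_complex_ofReal, integral_complex_ofReal, hcos, hsin]
  simp

open Real in
lemma eq_of_lintegral_sinKernel_le {μ ν : Measure ℝ} [IsProbabilityMeasure μ]
    [IsProbabilityMeasure ν]
    (hμ : ∫⁻ p, sinKernel p.1 p.2 ∂(μ.prod μ) ≤ ENNReal.ofReal (log 2))
    (hν : ∫⁻ p, sinKernel p.1 p.2 ∂(ν.prod ν) ≤ ENNReal.ofReal (log 2)) : μ = ν := by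
  have : Fact (0 < π) := ⟨pi_pos⟩
  have he := measurableEmbedding_arctanCircle
  have hmap : μ.map arctanCircle = ν.map arctanCircle := by
    refine AddCircle.measure_ext_of_integral_fourier fun n => ?_
    rw [he.integral_map, he.integral_map]
    rcases eq_or_ne n 0 with rfl | hn
    · simp
    · rw [integral_fourier_eq_zero hμ hn, integral_fourier_eq_zero hν hn]
  rw [← he.comap_map μ, hmap, he.comap_map]

open Real in
/-- The standard Cauchy distribution. -/
noncomputable def stdCauchy : Measure ℝ :=
  volume.withDensity (fun x : ℝ => ENNReal.ofReal (1 / (π * (1 + x ^ 2))))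

open Real in
/-- Under the standard Cauchy distribution the angle `arctan` is uniform. -/
lemma lintegral_stdCauchy {g : ℝ → ℝ≥0∞} (hg : Measurable g) :
    ∫⁻ x, g (arctan x) ∂stdCauchy =
      ENNReal.ofReal (1 / π) * ∫⁻ t in Set.Ioo (-(π / 2)) (π / 2), g t := by
  rw [← range_arctan, ← Set.image_univ, lintegral_image_eq_lintegral_abs_deriv_mul .univ
    (fun x _ => (hasDerivAt_arctan x).hasDerivWithinAt) arctan_injective.injOn, Measure.restrict_univ,
    ← lintegral_const_mul _ (by fun_prop), stdCauchy,
    lintegral_withDensity_eq_lintegral_mul _ (by fun_prop) (by fun_prop)]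
  refine lintegral_congr fun x => ?_
  rw [Pi.mul_apply, ← mul_assoc, ← ENNReal.ofReal_mul (by positivity),
    abs_of_nonneg (by positivity), div_mul_div_comm, one_mul]

open Real in
instance isProbabilityMeasure_stdCauchy : IsProbabilityMeasure stdCauchy := by
  refine ⟨?_⟩
  have h := lintegral_stdCauchy (g := fun _ => 1) measurable_const
  rw [lintegral_one] at h
  rw [h, setLIntegral_one, volume_Ioo, ← ENNReal.ofReal_mul (by positivity)]
  simp

open Real in
lemma lintegral_neg_log_abs_sin_sub (a : ℝ) :
    ∫⁻ t in Set.Ioo (-(π / 2)) (π / 2), ENNReal.ofReal (-log |sin (a - t)|) =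
      ENNReal.ofReal (π * log 2) := by
  have hper : Function.Periodic (fun t => -log (sin t)) π := fun t => by
    simp [sin_add_pi]
  have hii : IntervalIntegrable (fun t => -log (sin (a - t))) volume (-(π / 2)) (π / 2) := by
    have := (intervalIntegrable_log_sin (a := a + π / 2) (b := a - π / 2)).neg.comp_sub_left a
    simpa [Function.comp_def] using this
  have hle : -(π / 2) ≤ π / 2 := by linarith [pi_pos]
  have hval : ∫ t in (-(π / 2))..(π / 2), -log (sin (a - t)) = π * log 2 := by
    rw [intervalIntegral.integral_comp_sub_left (fun t => -log (sin t)) a,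
      show a - -(π / 2) = (a - π / 2) + π by ring, hper.intervalIntegral_add_eq _ 0, zero_add,
      intervalIntegral.integral_neg, integral_log_sin_zero_pi]
    ring
  simp_rw [log_abs]
  rw [← hval, intervalIntegral.integral_of_le hle, integral_Ioc_eq_integral_Ioo,
    ofReal_integral_eq_lintegral_ofReal (hii.1.mono_set Set.Ioo_subset_Ioc_self)]
  refine .of_forall fun t => ?_
  rw [Pi.zero_apply]
  beta_reduce
  rw [← log_abs]
  exact neg_nonneg.2 (log_nonpos (abs_nonneg _) (abs_sin_le_one _))

open Real in
lemma lintegral_sinKernel_stdCauchy :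
    ∫⁻ p, sinKernel p.1 p.2 ∂(stdCauchy.prod stdCauchy) = ENNReal.ofReal (log 2) := by
  have hmeas : Measurable fun p : ℝ × ℝ => sinKernel p.1 p.2 :=
    Measurable.ite (measurableSet_eq_fun measurable_fst measurable_snd) measurable_const
      (by fun_prop)
  have : NullSingletonClass stdCauchy := by unfold stdCauchy; infer_instance
  have hinner (x : ℝ) : ∫⁻ y, sinKernel x y ∂stdCauchy = ENNReal.ofReal (log 2) := by
    have hae : ∀ᵐ y ∂stdCauchy,
        sinKernel x y = ENNReal.ofReal (-log |sin (arctan x - arctan y)|) := by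
      filter_upwards [compl_mem_ae_iff.2 (measure_singleton (μ := stdCauchy) x)] with y hy
      exact if_neg fun h => hy h.symm
    rw [lintegral_congr_ae hae,
      lintegral_stdCauchy (g := fun t => ENNReal.ofReal (-log |sin (arctan x - t)|))
        (by fun_prop), lintegral_neg_log_abs_sin_sub, ← ENNReal.ofReal_mul (by positivity)]
    congr 1
    field_simp
  rw [lintegral_prod _ hmeas.aemeasurable]
  simp [hinner]

theorem cauchy_is_unique_minimizer (μ : ProbabilityMeasure ℝ) :
    (μ : Measure ℝ) =
        volume.withDensity (fun x : ℝ => ENNReal.ofReal (1 / (Real.pi * (1 + x ^ 2)))) ↔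
      ∀ ν : ProbabilityMeasure ℝ,
        energy 2 (fun x : ℝ => ((Real.log (1 + x ^ 2) : ℝ) : EReal)) (μ : Measure ℝ) ≤
          energy 2 (fun x : ℝ => ((Real.log (1 + x ^ 2) : ℝ) : EReal)) (ν : Measure ℝ) := by
  simp_rw [energy_log_one_add_sq, EReal.coe_ennreal_le_coe_ennreal_iff]
  change (μ : Measure ℝ) = stdCauchy ↔ _
  constructor
  · intro h ν
    rw [h, lintegral_sinKernel_stdCauchy]
    simpa using log_two_add_le_lintegral_sinKernel (ν : Measure ℝ) 0
  · intro h
    refine eq_of_lintegral_sinKernel_le ?_ lintegral_sinKernel_stdCauchy.le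
    simpa [lintegral_sinKernel_stdCauchy] using h ⟨stdCauchy, inferInstance⟩
end

section
/- Let (α_N) and (Z_N) be sequences of positive real numbers with α_N → +∞, and let Φ : M_1(X̂) → ℝ ∪ {+∞} be lower semicontinuous such that: (a) Φ(μ) = +∞ whenever μ({∞}) > 0; and (b) for all μ ∈ M_1(X̂), limsup_{δ→0} limsup_{N→∞} (1/α_N) log ( Z_N · P_N( T_*μ^N ∈ B(μ,δ) ) ) ≤ − Φ(μ), where B(μ,δ) is the ball of radius δ around μ for a metric on M_1(X̂) compatible with its weak topology. Then for every closed set F ⊂ M_1(X), limsup_{N→∞} (1/α_N) log ( Z_N · P_N( μ^N ∈ F ) ) ≤ − inf_{μ∈F} Φ(T_*μ). -/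
open MeasureTheory Filter Topology
open scoped ENNReal NNReal

theorem inv_mul_log_le_iff {a : ℝ} (ha : 0 < a) (x : ℝ≥0∞) (c : ℝ) :
    ((a⁻¹ : ℝ) : EReal) * ENNReal.log x ≤ c ↔ x ≤ ENNReal.ofReal (Real.exp (a * c)) := by
  rw [EReal.coe_inv, ← EReal.div_eq_inv_mul,
    EReal.div_le_iff_le_mul (EReal.coe_pos.2 ha) (EReal.coe_ne_top a), ← EReal.coe_mul,
    ← EReal.log_exp ((a * c : ℝ) : EReal), ENNReal.log_le_log_iff, EReal.exp_coe]

/-- The exponential growth rate of a finite union is bounded by any bound on the growth rates of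
its members. -/
theorem limsup_inv_mul_log_le_of_subset_biUnion {Ω ι : Type*} [MeasurableSpace Ω]
    (P : ℕ → Measure Ω) {a Z : ℕ → ℝ} (hpos : ∀ N, 0 < a N) (htop : Tendsto a atTop atTop)
    (s : Finset ι) {E : ℕ → Set Ω} {A : ι → ℕ → Set Ω} (hE : ∀ N, E N ⊆ ⋃ i ∈ s, A i N) {c : ℝ}
    (hA : ∀ i ∈ s, limsup (fun N ↦ (((a N)⁻¹ : ℝ) : EReal) *
      ENNReal.log (ENNReal.ofReal (Z N) * P N (A i N))) atTop < c) :
    limsup (fun N ↦ (((a N)⁻¹ : ℝ) : EReal) *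
      ENNReal.log (ENNReal.ofReal (Z N) * P N (E N))) atTop ≤ c := by
  refine EReal.le_of_forall_lt_iff_le.1 fun b hb ↦ ?_
  have hcb : 0 < b - c := sub_pos.2 (EReal.coe_lt_coe_iff.1 hb)
  have hcard : ∀ᶠ N in atTop, (s.card : ℝ) ≤ Real.exp (a N * (b - c)) :=
    (Real.tendsto_exp_atTop.comp (htop.atTop_mul_const hcb)).eventually_ge_atTop _
  have hall : ∀ᶠ N in atTop, ∀ i ∈ s, (((a N)⁻¹ : ℝ) : EReal) *
      ENNReal.log (ENNReal.ofReal (Z N) * P N (A i N)) < c :=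
    (Finset.eventually_all s).2 fun i hi ↦ eventually_lt_of_limsup_lt (hA i hi)
  refine limsup_le_of_le (by isBoundedDefault) ?_
  filter_upwards [hcard, hall] with N hN hAN
  rw [inv_mul_log_le_iff (hpos N)]
  calc ENNReal.ofReal (Z N) * P N (E N)
      ≤ ENNReal.ofReal (Z N) * ∑ i ∈ s, P N (A i N) := by
        gcongr
        exact (measure_mono (hE N)).trans (measure_biUnion_finset_le s _)
    _ = ∑ i ∈ s, ENNReal.ofReal (Z N) * P N (A i N) := Finset.mul_sum _ _ _
    _ ≤ ∑ _i ∈ s, ENNReal.ofReal (Real.exp (a N * c)) :=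
        Finset.sum_le_sum fun i hi ↦ (inv_mul_log_le_iff (hpos N) _ _).1 (hAN i hi).le
    _ = ENNReal.ofReal (s.card * Real.exp (a N * c)) := by
        rw [Finset.sum_const, nsmul_eq_mul, ENNReal.ofReal_mul (Nat.cast_nonneg _),
          ENNReal.ofReal_natCast]
    _ ≤ ENNReal.ofReal (Real.exp (a N * b)) := by
        refine ENNReal.ofReal_le_ofReal ?_
        calc (s.card : ℝ) * Real.exp (a N * c)
            ≤ Real.exp (a N * (b - c)) * Real.exp (a N * c) := by gcongr
          _ = Real.exp (a N * b) := by rw [← Real.exp_add]; ring_nf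

/-- Pushing forward along an open embedding into a separable metrizable space induces the weak
topology. -/
theorem isInducing_probabilityMeasure_map {X Y : Type*} [TopologicalSpace X]
    [MeasurableSpace X] [BorelSpace X] [TopologicalSpace Y]
    [TopologicalSpace.PseudoMetrizableSpace Y] [TopologicalSpace.SeparableSpace Y]
    [MeasurableSpace Y] [BorelSpace Y] {f : X → Y} (hf : IsOpenEmbedding f) :
    IsInducing fun μ : ProbabilityMeasure X ↦ μ.map hf.continuous.measurable.aemeasurable := by
  refine isInducing_iff_nhds.2 fun μ ↦ le_antisymm
    (ProbabilityMeasure.continuous_map hf.continuous).continuousAt.le_comap ?_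
  refine tendsto_of_forall_isOpen_le_liminf' (μs := id)
    (L := comap _ (𝓝 (μ.map hf.continuous.measurable.aemeasurable))) fun G hG ↦ ?_
  have hmap (ν : ProbabilityMeasure X) :
      (ν.map hf.continuous.measurable.aemeasurable : Measure Y) (f '' G) = (ν : Measure X) G := by
    rw [ProbabilityMeasure.map_apply' _ _ (hf.isOpenMap G hG).measurableSet,
      Set.preimage_image_eq _ hf.injective]
  have h := ProbabilityMeasure.le_liminf_measure_open_of_tendsto
    (tendsto_comap (f := fun ν : ProbabilityMeasure X ↦
      ν.map hf.continuous.measurable.aemeasurable)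
      (x := 𝓝 (μ.map hf.continuous.measurable.aemeasurable))) (hf.isOpenMap G hG)
  simpa only [hmap, id] using h

/-- A probability measure carried by the range of a measurable embedding is a pushforward. -/
theorem exists_probabilityMeasure_map_eq {X Y : Type*} [MeasurableSpace X] [MeasurableSpace Y]
    {f : X → Y} (hf : MeasurableEmbedding f) (μ : ProbabilityMeasure Y)
    (hμ : (μ : Measure Y) (Set.range f)ᶜ = 0) :
    ∃ ν : ProbabilityMeasure X, ν.map hf.measurable.aemeasurable = μ := by
  have hmap : ((μ : Measure Y).comap f).map f = μ := by
    rw [hf.map_comap]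
    exact Measure.restrict_eq_self_of_ae_mem (mem_ae_iff.2 hμ)
  have hprob : IsProbabilityMeasure ((μ : Measure Y).comap f) := by
    refine ⟨?_⟩
    rw [← Set.preimage_univ (f := f), ← Measure.map_apply hf.measurable MeasurableSet.univ, hmap,
      measure_univ]
  exact ⟨⟨_, hprob⟩, Subtype.ext hmap⟩

theorem compactification_upper_bound
    {X Xhat : Type*} [TopologicalSpace X] [PolishSpace X] [LocallyCompactSpace X]
    [NoncompactSpace X] [MeasurableSpace X] [BorelSpace X]
    [TopologicalSpace Xhat] [CompactSpace Xhat] [PolishSpace Xhat]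
    [MeasurableSpace Xhat] [BorelSpace Xhat]
    -- `(Xhat, T)` is a one-point compactification of `X` with point at infinity `infty`:
    (T : X → Xhat) (hT : Topology.IsEmbedding T) (infty : Xhat)
    (hrange : Set.range T = {infty}ᶜ)
    -- the random variables `μ^N`, defined on probability spaces `(Ω, P N)`:
    {Ω : Type*} [MeasurableSpace Ω] (P : ℕ → Measure Ω)
    (hP : ∀ N, IsProbabilityMeasure (P N)) (μN : ℕ → Ω → ProbabilityMeasure X)
    -- the sequences `α_N → ∞` and `Z_N` of positive reals:
    (αs Zs : ℕ → ℝ) (hαpos : ∀ N, 0 < αs N)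
    (hαtop : Filter.Tendsto αs Filter.atTop Filter.atTop) (hZpos : ∀ N, 0 < Zs N)
    -- `d` is a metric on `M_1(Xhat)` compatible with its weak topology:
    (d : ProbabilityMeasure Xhat → ProbabilityMeasure Xhat → ℝ)
    (hd : ∀ μ : ProbabilityMeasure Xhat,
      (nhds μ).HasBasis (fun δ : ℝ => 0 < δ) (fun δ => {ν | d μ ν < δ}))
    -- the lower semicontinuous functional `Φ`:
    (Φ : ProbabilityMeasure Xhat → EReal) (hΦ : LowerSemicontinuous Φ)
    -- (a) `Φ(μ) = ⊤` as soon as `μ({∞}) > 0`: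
    (hΦtop : ∀ μ : ProbabilityMeasure Xhat, 0 < (μ : Measure Xhat) {infty} → Φ μ = ⊤)
    -- (b) the upper bound on deviations of `T_*μ^N` towards small balls:
    (hballs : ∀ μ : ProbabilityMeasure Xhat,
      Filter.limsup
          (fun δ : ℝ => Filter.limsup
            (fun N : ℕ => (((αs N)⁻¹ : ℝ) : EReal) *
              ENNReal.log (ENNReal.ofReal (Zs N) *
                P N {ω | d μ ((μN N ω).map hT.continuous.measurable.aemeasurable) < δ}))
            Filter.atTop)
          (nhdsWithin (0 : ℝ) (Set.Ioi 0))
        ≤ - Φ μ)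
    (F : Set (ProbabilityMeasure X)) (hF : IsClosed F) :
    Filter.limsup
        (fun N : ℕ => (((αs N)⁻¹ : ℝ) : EReal) *
          ENNReal.log (ENNReal.ofReal (Zs N) * P N {ω | μN N ω ∈ F}))
        Filter.atTop
      ≤ - ⨅ μ ∈ F, Φ ((μ : ProbabilityMeasure X).map hT.continuous.measurable.aemeasurable) := by
  have hemb : IsOpenEmbedding T := ⟨hT, hrange ▸ isOpen_compl_singleton⟩
  let push : ProbabilityMeasure X → ProbabilityMeasure Xhat :=
    fun μ ↦ μ.map hT.continuous.measurable.aemeasurable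
  have hpush : IsInducing push := isInducing_probabilityMeasure_map hemb
  refine EReal.le_of_forall_lt_iff_le.1 fun c hc ↦ ?_
  have hΦlt : ∀ μ ∈ closure (push '' F), -Φ μ < c := by
    intro μ hμ
    rcases eq_or_ne ((μ : Measure Xhat) {infty}) 0 with h0 | h0
    · obtain ⟨ν, rfl⟩ := exists_probabilityMeasure_map_eq hemb.measurableEmbedding μ
        (by rwa [hrange, compl_compl])
      have hν : ν ∈ F := by
        rw [← hF.closure_eq, hpush.closure_eq_preimage_closure_image]
        exact hμ
      exact (EReal.neg_le_neg_iff.2 (iInf₂_le ν hν)).trans_lt hc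
    · rw [hΦtop μ (pos_iff_ne_zero.2 h0), EReal.neg_top]
      exact EReal.bot_lt_coe c
  have hδ : ∀ μ ∈ closure (push '' F), ∃ δ : ℝ, 0 < δ ∧
      limsup (fun N : ℕ => (((αs N)⁻¹ : ℝ) : EReal) *
        ENNReal.log (ENNReal.ofReal (Zs N) * P N {ω | d μ (push (μN N ω)) < δ})) atTop < c := by
    intro μ hμ
    have hlt := eventually_lt_of_limsup_lt ((hballs μ).trans_lt (hΦlt μ hμ))
    obtain ⟨δ, hδlt, hδpos⟩ := (hlt.and self_mem_nhdsWithin).exists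
    exact ⟨δ, hδpos, hδlt⟩
  choose! δ hδpos hδlt using hδ
  obtain ⟨s, hs, hcover⟩ := isClosed_closure.isCompact.elim_nhds_subcover
    (fun μ ↦ {ν | d μ ν < δ μ}) fun μ hμ ↦ (hd μ).mem_of_mem (hδpos μ hμ)
  refine limsup_inv_mul_log_le_of_subset_biUnion P hαpos hαtop s
    (A := fun μ N ↦ {ω | d μ (push (μN N ω)) < δ μ}) (fun N ω hω ↦ ?_)
    fun μ hμ ↦ hδlt μ (hs μ hμ)
  simpa using hcover (subset_closure (Set.mem_image_of_mem push hω))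
end
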